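/- arXiv:math/0012073 — 2 statements merged into one kernel-verified Lean document; each statement's English description precedes it below -/
import Mathlib

section
/- Let H = {H_α}_{α∈π} be a finite dimensional Hopf π-coalgebra over a field k. Then every H_α is a semisimple k-algebra if and only if H_1 is a semisimple k-algebra. -/
open scoped TensorProduct

noncomputable section

/-- Transport of the algebra structure along an equality of group indices. -/
def gcast (k : Type*) [CommSemiring k] {π : Type*} (H : π → Type*)
    [∀ α, Ring (H α)] [∀ α, Algebra k (H α)] {a b : π} (h : a = b) :
    H a ≃ₐ[k] H b := by subst h; exact AlgEquiv.refl

/-- Transport of a module family along an equality of group indices. -/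
def fcast (k : Type*) [CommSemiring k] {π : Type*} (M : π → Type*)
    [∀ α, AddCommGroup (M α)] [∀ α, Module k (M α)] {a b : π} (h : a = b) :
    M a ≃ₗ[k] M b := by subst h; exact LinearEquiv.refl k (M a)

/-- A Hopf `π`-coalgebra (in the sense of Turaev/Virelizier) over a field `k`:
a family of `k`-algebras `H α` with comultiplication `Δ`, counit `ε` and antipode `S`. -/
class HopfGCoalgebra (k : Type*) [Field k] {π : Type*} [Group π]
    (H : π → Type*) [∀ α, Ring (H α)] [∀ α, Algebra k (H α)] where
  Δ : ∀ α β : π, H (α * β) →ₐ[k] H α ⊗[k] H β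
  ε : H (1 : π) →ₐ[k] k
  S : ∀ α : π, H α →ₗ[k] H α⁻¹
  coassoc : ∀ α β γ : π,
    (TensorProduct.assoc k (H α) (H β) (H γ)).toLinearMap ∘ₗ
        (TensorProduct.map (Δ α β).toLinearMap (LinearMap.id : H γ →ₗ[k] H γ)) ∘ₗ
        (Δ (α * β) γ).toLinearMap
      = (TensorProduct.map (LinearMap.id : H α →ₗ[k] H α) (Δ β γ).toLinearMap) ∘ₗ
        (Δ α (β * γ)).toLinearMap ∘ₗ (gcast k H (mul_assoc α β γ)).toLinearMap
  counit_right : ∀ α : π,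
    (TensorProduct.rid k (H α)).toLinearMap ∘ₗ
        (TensorProduct.map (LinearMap.id : H α →ₗ[k] H α) ε.toLinearMap) ∘ₗ
        (Δ α 1).toLinearMap ∘ₗ (gcast k H (mul_one α).symm).toLinearMap = LinearMap.id
  counit_left : ∀ α : π,
    (TensorProduct.lid k (H α)).toLinearMap ∘ₗ
        (TensorProduct.map ε.toLinearMap (LinearMap.id : H α →ₗ[k] H α)) ∘ₗ
        (Δ 1 α).toLinearMap ∘ₗ (gcast k H (one_mul α).symm).toLinearMap = LinearMap.id
  antipode_left : ∀ α : π,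
    (LinearMap.mul' k (H α)) ∘ₗ
        (TensorProduct.map ((gcast k H (inv_inv α)).toLinearMap ∘ₗ S α⁻¹)
          (LinearMap.id : H α →ₗ[k] H α)) ∘ₗ (Δ α⁻¹ α).toLinearMap
      = (Algebra.linearMap k (H α)) ∘ₗ ε.toLinearMap ∘ₗ
        (gcast k H (inv_mul_cancel α)).toLinearMap
  antipode_right : ∀ α : π,
    (LinearMap.mul' k (H α)) ∘ₗ
        (TensorProduct.map (LinearMap.id : H α →ₗ[k] H α)
          ((gcast k H (inv_inv α)).toLinearMap ∘ₗ S α⁻¹)) ∘ₗ (Δ α α⁻¹).toLinearMap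
      = (Algebra.linearMap k (H α)) ∘ₗ ε.toLinearMap ∘ₗ
        (gcast k H (mul_inv_cancel α)).toLinearMap

namespace HopfGCoalgebra

variable (k : Type*) [Field k] {π : Type*} [Group π] (H : π → Type*)
  [∀ α, Ring (H α)] [∀ α, Algebra k (H α)] [HopfGCoalgebra k H]

/-- A left `π`-integral for `H`. -/
def IsLeftIntegral (lam : ∀ α : π, H α →ₗ[k] k) : Prop :=
  ∀ (α β : π) (x : H (α * β)),
    (TensorProduct.rid k (H α))
        (TensorProduct.map (LinearMap.id : H α →ₗ[k] H α) (lam β) (Δ α β x))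
      = lam (α * β) x • (1 : H α)

/-- A right `π`-integral for `H`. -/
def IsRightIntegral (lam : ∀ α : π, H α →ₗ[k] k) : Prop :=
  ∀ (α β : π) (x : H (α * β)),
    (TensorProduct.lid k (H β))
        (TensorProduct.map (lam α) (LinearMap.id : H β →ₗ[k] H β) (Δ α β x))
      = lam (α * β) x • (1 : H β)

/-- A `π`-grouplike element of `H`. -/
def IsGrouplike (g : ∀ α : π, H α) : Prop :=
  (∀ α β : π, Δ α β (g (α * β)) = g α ⊗ₜ[k] g β) ∧ ε (k := k) (H := H) (g 1) = 1

/-- `g` is the distinguished `π`-grouplike element of `H`. -/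
def IsDistinguishedGrouplike (g : ∀ α : π, H α) : Prop :=
  IsGrouplike k H g ∧
    ∀ lam : ∀ α : π, H α →ₗ[k] k, IsRightIntegral k H lam →
      ∀ (α β : π) (x : H (α * β)),
        (TensorProduct.rid k (H α))
            (TensorProduct.map (LinearMap.id : H α →ₗ[k] H α) (lam β) (Δ α β x))
          = lam (α * β) x • g α

/-- `ν` is the distinguished grouplike element of `H₁*`. -/
def IsDistinguishedNu (ν : H (1 : π) →ₐ[k] k) : Prop :=
  ∀ Λ : H (1 : π), (∀ x : H (1 : π), x * Λ = ε (k := k) (H := H) x • Λ) →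
    ∀ x : H (1 : π), Λ * x = ν x • Λ

/-- The right action `a ↼ f` of `f ∈ H₁*` on `a ∈ H α`. -/
def hitR (f : H (1 : π) →ₗ[k] k) {α : π} (a : H α) : H α :=
  (TensorProduct.lid k (H α))
    (TensorProduct.map f (LinearMap.id : H α →ₗ[k] H α)
      (Δ 1 α ((gcast k H (one_mul α).symm) a)))

/-- The left action `f ⇀ a` of `f ∈ H₁*` on `a ∈ H α`. -/
def hitL (f : H (1 : π) →ₗ[k] k) {α : π} (a : H α) : H α :=
  (TensorProduct.rid k (H α))
    (TensorProduct.map (LinearMap.id : H α →ₗ[k] H α) f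
      (Δ α 1 ((gcast k H (mul_one α).symm) a)))


/-- The comultiplication, with all arguments explicit. -/
def comul (α β : π) : H (α * β) →ₐ[k] H α ⊗[k] H β := Δ α β

/-- The counit, with all arguments explicit. -/
def counit : H (1 : π) →ₐ[k] k := ε

/-- The antipode, with all arguments explicit. -/
def antipode (α : π) : H α →ₗ[k] H α⁻¹ := S α

end HopfGCoalgebra

open HopfGCoalgebra
/-- A right Hopf `π`-comodule over `H`. -/
class HopfGComodule (k : Type*) [Field k] {π : Type*} [Group π]
    (H : π → Type*) [∀ α, Ring (H α)] [∀ α, Algebra k (H α)] [HopfGCoalgebra k H]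
    (M : π → Type*) [∀ α, AddCommGroup (M α)] [∀ α, Module k (M α)] where
  ρ : ∀ α β : π, M (α * β) →ₗ[k] M α ⊗[k] H β
  ρ_coassoc : ∀ α β γ : π,
    (TensorProduct.assoc k (M α) (H β) (H γ)).toLinearMap ∘ₗ
        (TensorProduct.map (ρ α β) (LinearMap.id : H γ →ₗ[k] H γ)) ∘ₗ (ρ (α * β) γ)
      = (TensorProduct.map (LinearMap.id : M α →ₗ[k] M α) (Δ β γ).toLinearMap) ∘ₗ
        (ρ α (β * γ)) ∘ₗ (fcast k M (mul_assoc α β γ)).toLinearMap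
  ρ_counit : ∀ α : π,
    (TensorProduct.rid k (M α)).toLinearMap ∘ₗ
        (TensorProduct.map (LinearMap.id : M α →ₗ[k] M α)
          (ε (k := k) (H := H)).toLinearMap) ∘ₗ
        (ρ α 1) ∘ₗ (fcast k M (mul_one α).symm).toLinearMap = LinearMap.id
  act : ∀ α : π, M α →ₗ[k] H α →ₗ[k] M α
  act_one : ∀ (α : π) (m : M α), act α m 1 = m
  act_mul : ∀ (α : π) (m : M α) (a b : H α), act α (act α m a) b = act α m (a * b)
  ρ_act : ∀ (α β : π) (m : M (α * β)) (a : H (α * β)),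
    ρ α β (act (α * β) m a)
      = TensorProduct.map (TensorProduct.lift (act α)) (LinearMap.mul' k (H β))
          ((TensorProduct.tensorTensorTensorComm k (M α) (H β) (H α) (H β))
            (ρ α β m ⊗ₜ[k] (Δ α β a)))

namespace HopfGComodule

variable (k : Type*) [Field k] {π : Type*} [Group π] (H : π → Type*)
  [∀ α, Ring (H α)] [∀ α, Algebra k (H α)] [HopfGCoalgebra k H]
  (M : π → Type*) [∀ α, AddCommGroup (M α)] [∀ α, Module k (M α)] [HopfGComodule k H M]

/-- The submodule of coinvariant families of `H` on `M`. -/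
def coinvFam : Submodule k (∀ α, M α) where
  carrier := {m | ∀ α β : π, ρ (H := H) α β (m (α * β)) = m α ⊗ₜ[k] (1 : H β)}
  add_mem' := by
    intro a b ha hb α β
    simp only [Pi.add_apply, map_add, ha α β, hb α β, TensorProduct.add_tmul]
  zero_mem' := by
    intro α β
    simp only [Pi.zero_apply, map_zero, TensorProduct.zero_tmul]
  smul_mem' := by
    intro c a ha α β
    simp only [Pi.smul_apply, map_smul, ha α β, TensorProduct.smul_tmul']

/-- The `α`-component of the `π`-subcomodule of coinvariants. -/
def coinvSub (α : π) : Submodule k (M α) :=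
  (coinvFam k H M).map (LinearMap.proj α : (∀ γ, M γ) →ₗ[k] M α)


/-- The comodule structure maps, with all arguments explicit. -/
def coact (α β : π) : M (α * β) →ₗ[k] M α ⊗[k] H β := ρ α β

/-- The right `H α`-action on `M α`, with all arguments explicit. -/
def hact (α : π) : M α →ₗ[k] H α →ₗ[k] M α := act α

end HopfGComodule

section Cosemisimple

variable (k : Type*) [Field k] {π : Type*} [Group π] (H : π → Type*)
  [∀ α, Ring (H α)] [∀ α, Algebra k (H α)]
  (M : π → Type*) [∀ α, AddCommGroup (M α)] [∀ α, Module k (M α)]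

/-- `N` is a `π`-subcomodule of the right `π`-comodule `(M, ρ)` over `H`. -/
def IsGSubcomodule (ρ : ∀ α β : π, M (α * β) →ₗ[k] M α ⊗[k] H β)
    (N : ∀ α, Submodule k (M α)) : Prop :=
  ∀ (α β : π), ∀ x ∈ N (α * β),
    ρ α β x ∈ LinearMap.range
      (TensorProduct.map (N α).subtype (LinearMap.id : H β →ₗ[k] H β))

/-- `N` is a simple `π`-subcomodule of `(M, ρ)`. -/
def IsSimpleGSubcomodule (ρ : ∀ α β : π, M (α * β) →ₗ[k] M α ⊗[k] H β)
    (N : ∀ α, Submodule k (M α)) : Prop :=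
  IsGSubcomodule k H M ρ N ∧ (∃ α, N α ≠ ⊥) ∧
    ∀ P : ∀ α, Submodule k (M α), IsGSubcomodule k H M ρ P → (∀ α, P α ≤ N α) →
      (∀ α, P α = ⊥) ∨ P = N

/-- The right `π`-comodule `(M, ρ)` is cosemisimple: it is the sum of its simple
`π`-subcomodules. -/
def IsGCosemisimple (ρ : ∀ α β : π, M (α * β) →ₗ[k] M α ⊗[k] H β) : Prop :=
  ∀ α : π,
    (⨆ N : {N : ∀ γ, Submodule k (M γ) // IsSimpleGSubcomodule k H M ρ N}, N.1 α) = ⊤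

end Cosemisimple

section CoalgCosemisimple

variable (k : Type*) [Field k] (C : Type*) [AddCommGroup C] [Module k C]

/-- `N` is a subcomodule of the coalgebra `(C, δ)` viewed as a right comodule over itself. -/
def IsSubcoideal (δ : C →ₗ[k] C ⊗[k] C) (N : Submodule k C) : Prop :=
  ∀ x ∈ N, δ x ∈ LinearMap.range (TensorProduct.map N.subtype (LinearMap.id : C →ₗ[k] C))

def IsSimpleSubcoideal (δ : C →ₗ[k] C ⊗[k] C) (N : Submodule k C) : Prop :=
  IsSubcoideal k C δ N ∧ N ≠ ⊥ ∧
    ∀ P : Submodule k C, IsSubcoideal k C δ P → P ≤ N → P = ⊥ ∨ P = N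

/-- The coalgebra `(C, δ)` is cosemisimple. -/
def IsCosemisimpleCoalgebra (δ : C →ₗ[k] C ⊗[k] C) : Prop :=
  (⨆ N : {N : Submodule k C // IsSimpleSubcoideal k C δ N}, N.1) = ⊤

end CoalgCosemisimple
/-- A crossed Hopf `π`-coalgebra: a Hopf `π`-coalgebra with a crossing `φ`. -/
class CrossedHopfGCoalgebra (k : Type*) [Field k] {π : Type*} [Group π]
    (H : π → Type*) [∀ α, Ring (H α)] [∀ α, Algebra k (H α)]
    extends HopfGCoalgebra k H where
  φ : ∀ β α : π, H α ≃ₐ[k] H (β * α * β⁻¹)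
  φ_comul : ∀ β α γ : π,
    (TensorProduct.map (φ β α).toLinearMap (φ β γ).toLinearMap) ∘ₗ (Δ α γ).toLinearMap
      = (Δ (β * α * β⁻¹) (β * γ * β⁻¹)).toLinearMap ∘ₗ
        (gcast k H (show β * (α * γ) * β⁻¹ = (β * α * β⁻¹) * (β * γ * β⁻¹) by
          group)).toLinearMap ∘ₗ (φ β (α * γ)).toLinearMap
  φ_counit : ∀ (β : π) (x : H (1 : π)),
    ε ((gcast k H (show β * 1 * β⁻¹ = (1 : π) by group)) (φ β 1 x)) = ε x
  φ_mul : ∀ (β β' α : π) (x : H α),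
    (gcast k H (show β * (β' * α * β'⁻¹) * β⁻¹ = (β * β') * α * (β * β')⁻¹ by group))
        (φ β (β' * α * β'⁻¹) (φ β' α x))
      = φ (β * β') α x


namespace CrossedHopfGCoalgebra

variable (k : Type*) [Field k] {π : Type*} [Group π] (H : π → Type*)
  [∀ α, Ring (H α)] [∀ α, Algebra k (H α)] [CrossedHopfGCoalgebra k H]

/-- The crossing, with all arguments explicit. -/
def crossing (β α : π) : H α ≃ₐ[k] H (β * α * β⁻¹) := φ β α

end CrossedHopfGCoalgebra

open CrossedHopfGCoalgebra

/-- A quasitriangular Hopf `π`-coalgebra: a crossed Hopf `π`-coalgebra with an R-matrix. -/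
class QTHopfGCoalgebra (k : Type*) [Field k] {π : Type*} [Group π]
    (H : π → Type*) [∀ α, Ring (H α)] [∀ α, Algebra k (H α)]
    extends CrossedHopfGCoalgebra k H where
  Rm : ∀ α β : π, H α ⊗[k] H β
  Rm_isUnit : ∀ α β : π, IsUnit (Rm α β)
  Rm_comul : ∀ (α β : π) (x : H (α * β)),
    Rm α β * Δ α β x
      = (TensorProduct.comm k (H β) (H α))
          ((TensorProduct.map
              ((gcast k H (show α⁻¹ * (α * β * α⁻¹) * α⁻¹⁻¹ = β by group)).toLinearMap ∘ₗ
                (φ α⁻¹ (α * β * α⁻¹)).toLinearMap)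
              (LinearMap.id : H α →ₗ[k] H α))
            ((Δ (α * β * α⁻¹) α)
              ((gcast k H (show α * β = (α * β * α⁻¹) * α by group)) x))) * Rm α β
  Rm_delta_right : ∀ α β γ : π,
    TensorProduct.map (LinearMap.id : H α →ₗ[k] H α) (Δ β γ).toLinearMap (Rm α (β * γ))
      = (TensorProduct.map (LinearMap.id : H α →ₗ[k] H α)
            (TensorProduct.mk k (H β) (H γ) 1) (Rm α γ))
        * (TensorProduct.map (LinearMap.id : H α →ₗ[k] H α)
            ((TensorProduct.mk k (H β) (H γ)).flip 1) (Rm α β))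
  Rm_delta_left : ∀ α β γ : π,
    (TensorProduct.assoc k (H α) (H β) (H γ))
        (TensorProduct.map (Δ α β).toLinearMap (LinearMap.id : H γ →ₗ[k] H γ)
          (Rm (α * β) γ))
      = (TensorProduct.map (LinearMap.id : H α →ₗ[k] H α)
            (TensorProduct.mk k (H β) (H γ) 1)
            (TensorProduct.map (LinearMap.id : H α →ₗ[k] H α)
              ((gcast k H (show β⁻¹ * (β * γ * β⁻¹) * β⁻¹⁻¹ = γ by group)).toLinearMap ∘ₗ
                (φ β⁻¹ (β * γ * β⁻¹)).toLinearMap)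
              (Rm α (β * γ * β⁻¹))))
        * (TensorProduct.mk k (H α) (H β ⊗[k] H γ) 1 (Rm β γ))
  Rm_phi : ∀ β α γ : π,
    TensorProduct.map (φ β α).toLinearMap (φ β γ).toLinearMap (Rm α γ)
      = Rm (β * α * β⁻¹) (β * γ * β⁻¹)

namespace QTHopfGCoalgebra

variable (k : Type*) [Field k] {π : Type*} [Group π] (H : π → Type*)
  [∀ α, Ring (H α)] [∀ α, Algebra k (H α)] [QTHopfGCoalgebra k H]

/-- The square of the antipode `S_{α⁻¹} ∘ S_α : H α → H α`. -/
def antipodeSq (α : π) : H α →ₗ[k] H α :=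
  (gcast k H (inv_inv α)).toLinearMap ∘ₗ S α⁻¹ ∘ₗ S α

/-- The map `S_{α⁻¹} ∘ φ_α : H (α⁻¹) → H α`. -/
def sphi (α : π) : H α⁻¹ →ₗ[k] H α :=
  (gcast k H (inv_inv α)).toLinearMap ∘ₗ S α⁻¹ ∘ₗ
    (gcast k H (show α * α⁻¹ * α⁻¹ = α⁻¹ by group)).toLinearMap ∘ₗ
    (φ α α⁻¹).toLinearMap

/-- The Drinfeld element `u_α = m_α ∘ (S_{α⁻¹}φ_α ⊗ id) ∘ σ_{α,α⁻¹} (R_{α,α⁻¹})`. -/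
def drinfeld (α : π) : H α :=
  LinearMap.mul' k (H α)
    (TensorProduct.map (sphi k H α) (LinearMap.id : H α →ₗ[k] H α)
      ((TensorProduct.comm k (H α) (H α⁻¹)) (Rm α α⁻¹)))

/-- The element `S_{α⁻¹}(u_{α⁻¹}) ∈ H α`. -/
def sdrinfeld (α : π) : H α :=
  (gcast k H (inv_inv α)) (S (k := k) (H := H) α⁻¹ (drinfeld k H α⁻¹))

/-- The `π`-grouplike element `ℓ_α = S_{α⁻¹}(u_{α⁻¹})⁻¹ u_α`. -/
def ell (α : π) : H α :=
  Ring.inverse (sdrinfeld k H α) * drinfeld k H α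


/-- The R-matrix, with all arguments explicit. -/
def rmatrix (α β : π) : H α ⊗[k] H β := Rm α β

end QTHopfGCoalgebra

open QTHopfGCoalgebra

/-- An algebra with a separability element, i.e. `e ∈ A ⊗ A` with `(h ⊗ 1) e = e (1 ⊗ h)`
whose product `m(e)` is `1`, is semisimple. -/
theorem IsSemisimpleRing.of_separability_element {k A : Type*} [Field k] [Ring A] [Algebra k A]
    (e : A ⊗[k] A) (he : ∀ h : A, (h ⊗ₜ[k] (1 : A)) * e = e * ((1 : A) ⊗ₜ[k] h))
    (he_one : LinearMap.mul' k A e = 1) : IsSemisimpleRing A := by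
  refine (isSemisimpleModule_iff A A).mpr ⟨fun I ↦ ?_⟩
  obtain ⟨p, hp⟩ := (I.restrictScalars k).exists_isCompl
  let q : A →ₗ[k] I := Submodule.projectionOnto (I.restrictScalars k) p hp
  have hq (x : A) (hx : x ∈ I) : q x = ⟨x, hx⟩ :=
    Submodule.projectionOnto_apply_left hp ⟨x, hx⟩
  let avg (x : A) : A ⊗[k] A →ₗ[k] I :=
    TensorProduct.lift (LinearMap.mk₂ k (fun a b ↦ a • q (b * x))
      (fun a a' b ↦ add_smul a a' _) (fun c a b ↦ smul_assoc c a _)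
      (fun a b b' ↦ by
        rw [add_mul, map_add, smul_add])
      (fun c a b ↦ by
        rw [smul_mul_assoc, map_smul, smul_comm]))
  have avg_tmul (x a b : A) : avg x (a ⊗ₜ b) = a • q (b * x) := rfl
  have avg_left (x h : A) (t : A ⊗[k] A) : avg x ((h ⊗ₜ 1) * t) = h • avg x t := by
    induction t with
    | zero => simp
    | tmul a b => simp [avg_tmul, mul_smul]
    | add s t hs ht => rw [mul_add, map_add, hs, ht, map_add, smul_add]
  have avg_right (x h : A) (t : A ⊗[k] A) : avg x (t * (1 ⊗ₜ h)) = avg (h * x) t := by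
    induction t with
    | zero => simp
    | tmul a b => simp [avg_tmul, mul_assoc]
    | add s t hs ht => rw [add_mul, map_add, hs, ht, map_add]
  have avg_add (x y : A) (t : A ⊗[k] A) : avg (x + y) t = avg x t + avg y t := by
    induction t with
    | zero => simp
    | tmul a b =>
      rw [avg_tmul, mul_add, map_add, smul_add, avg_tmul, avg_tmul]
    | add s t hs ht => rw [map_add, hs, ht, map_add, map_add]; abel
  have avg_mem (x : A) (hx : x ∈ I) (t : A ⊗[k] A) :
      (avg x t : A) = LinearMap.mul' k A t * x := by
    induction t with
    | zero => simp
    | tmul a b =>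
      rw [avg_tmul, hq (b * x) (I.smul_mem b hx)]
      simp [mul_assoc]
    | add s t hs ht => rw [map_add, Submodule.coe_add, hs, ht, map_add, add_mul]
  let P : A →ₗ[A] I :=
    { toFun := fun x ↦ avg x e
      map_add' := fun x y ↦ avg_add x y e
      map_smul' := fun h x ↦ by
        rw [smul_eq_mul, ← avg_right, ← he, avg_left, RingHom.id_apply] }
  refine ⟨LinearMap.ker P, LinearMap.isCompl_of_proj fun x ↦ Subtype.ext ?_⟩
  exact (avg_mem x x.2 e).trans (by rw [he_one, one_mul])

/-- A semisimple augmented algebra has a left integral of augmentation one. -/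
theorem IsSemisimpleRing.exists_left_integral {k K : Type*} [Field k] [Ring K] [Algebra k K]
    [IsSemisimpleRing K] (ε : K →ₐ[k] k) :
    ∃ Λ : K, (∀ x, x * Λ = ε x • Λ) ∧ ε Λ = 1 := by
  obtain ⟨C, hC⟩ := exists_isCompl (RingHom.ker ε : Ideal K)
  obtain ⟨u, hu, Λ, hΛ, h⟩ :=
    Submodule.mem_sup.mp (hC.sup_eq_top ▸ Submodule.mem_top (x := (1 : K)))
  refine ⟨Λ, fun x ↦ ?_, ?_⟩
  · have hx : (x - algebraMap k K (ε x)) * Λ ∈ RingHom.ker ε ⊓ C :=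
      ⟨by simp [RingHom.mem_ker], C.mul_mem_left _ hΛ⟩
    rw [hC.inf_eq_bot, Submodule.mem_bot, sub_mul, sub_eq_zero] at hx
    rw [hx, Algebra.smul_def]
  · have h1 := congrArg ε h
    rwa [map_add, (RingHom.mem_ker).mp hu, zero_add, map_one] at h1

theorem gcast_gcast {k : Type*} [CommSemiring k] {π : Type*} {H : π → Type*}
    [∀ α, Ring (H α)] [∀ α, Algebra k (H α)] {a b : π} (h : a = b) (h' : b = a) (x : H a) :
    gcast k H h' (gcast k H h x) = x := by
  subst h
  rfl

section PairOfComponents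

variable {k A B K : Type*} [Field k] [Ring A] [Ring B] [Ring K]
  [Algebra k A] [Algebra k B] [Algebra k K]
  {ΔAB : K →ₐ[k] A ⊗[k] B} {ΔBA : K →ₐ[k] B ⊗[k] A} {ε : K →ₐ[k] k} {S : B →ₗ[k] A}

/-- The identity `S(h₁ y) h₂ = ε(h) S(y)` for `h ∈ K = H₁` and `y ∈ B = H_{α⁻¹}`. -/
theorem antipode_mul_left {Δ1B : B →ₗ[k] K ⊗[k] B} {ΔB1 : B →ₗ[k] B ⊗[k] K}
    (coassoc : ∀ y, TensorProduct.assoc k B A B (TensorProduct.map ΔBA.toLinearMap .id (Δ1B y))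
      = TensorProduct.map .id ΔAB.toLinearMap (ΔB1 y))
    (counit_left : ∀ y, TensorProduct.lid k B (TensorProduct.map ε.toLinearMap .id (Δ1B y)) = y)
    (counit_right : ∀ y, TensorProduct.rid k B (TensorProduct.map .id ε.toLinearMap (ΔB1 y)) = y)
    (antipode_left : ∀ h, LinearMap.mul' k A (TensorProduct.map S .id (ΔBA h))
      = algebraMap k A (ε h))
    (antipode_right : ∀ h, LinearMap.mul' k A (TensorProduct.map .id S (ΔAB h))
      = algebraMap k A (ε h)) (h : K) (y : B) :
    LinearMap.mul' k A (TensorProduct.map S .id (ΔBA h * (y ⊗ₜ 1))) = ε h • S y := by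
  let G (t : B ⊗[k] A) : B ⊗[k] A →ₗ[k] A :=
    LinearMap.mul' k A ∘ₗ TensorProduct.map S .id ∘ₗ LinearMap.mulLeft k t
  have G_add (s t u : B ⊗[k] A) : G (s + t) u = G s u + G t u := by simp [G, add_mul]
  let L (t : B ⊗[k] A) : B ⊗[k] (A ⊗[k] B) →ₗ[k] A :=
    LinearMap.mul' k A ∘ₗ TensorProduct.map (G t) S ∘ₗ
      (TensorProduct.assoc k B A B).symm.toLinearMap
  have G_right (t : B ⊗[k] A) (b : B) (a : A) : G t (b ⊗ₜ a) = G t (b ⊗ₜ 1) * a := by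
    induction t with
    | zero => simp [G]
    | tmul b' a' => simp [G, mul_assoc]
    | add s t hs ht => rw [G_add, hs, ht, G_add, add_mul]
  have L_right (t : B ⊗[k] A) (b : B) (u : A ⊗[k] B) :
      L t (b ⊗ₜ u) = G t (b ⊗ₜ 1) * LinearMap.mul' k A (TensorProduct.map .id S u) := by
    induction u with
    | zero => simp
    | tmul a c => simp [L, G_right t b a, mul_assoc]
    | add s u hs hu => rw [TensorProduct.tmul_add, map_add, hs, hu, map_add, map_add, mul_add]
  have left (w : K ⊗[k] B) :
      L (ΔBA h) (TensorProduct.assoc k B A B (TensorProduct.map ΔBA.toLinearMap .id w))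
        = ε h • S (TensorProduct.lid k B (TensorProduct.map ε.toLinearMap .id w)) := by
    induction w with
    | zero => simp
    | tmul z c =>
      have hG : G (ΔBA h) (ΔBA z) = algebraMap k A (ε h * ε z) := by
        simp only [G, LinearMap.comp_apply, LinearMap.mulLeft_apply, ← map_mul, antipode_left]
      simp [L, hG, ← Algebra.smul_def, mul_smul, -map_mul]
    | add s w hs hw => simp only [map_add, hs, hw, smul_add]
  have right (v : B ⊗[k] K) :
      L (ΔBA h) (TensorProduct.map .id ΔAB.toLinearMap v)
        = G (ΔBA h) (TensorProduct.rid k B (TensorProduct.map .id ε.toLinearMap v) ⊗ₜ 1) := by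
    induction v with
    | zero => simp
    | tmul b z =>
      simp [L_right, antipode_right, ← Algebra.commutes, ← Algebra.smul_def,
        ← TensorProduct.smul_tmul']
    | add s w hs hw => simp only [map_add, hs, hw, TensorProduct.add_tmul]
  have key := left (Δ1B y)
  rw [coassoc, right, counit_left, counit_right] at key
  exact key

/-- The element `Λ₁ ⊗ S(Λ₂)` attached to a left integral `Λ` is balanced. -/
theorem integral_antipode_balanced {Δ1A : A →ₗ[k] K ⊗[k] A} {ΔA1 : A →ₗ[k] A ⊗[k] K}
    (coassoc : ∀ h, TensorProduct.assoc k A B A (TensorProduct.map ΔAB.toLinearMap .id (Δ1A h))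
      = TensorProduct.map .id ΔBA.toLinearMap (ΔA1 h))
    (counit_left : ∀ h, TensorProduct.lid k A (TensorProduct.map ε.toLinearMap .id (Δ1A h)) = h)
    (counit_right : ∀ h, TensorProduct.rid k A (TensorProduct.map .id ε.toLinearMap (ΔA1 h)) = h)
    (antipode_mul : ∀ h y, LinearMap.mul' k A (TensorProduct.map S .id (ΔBA h * (y ⊗ₜ 1)))
      = ε h • S y)
    {Λ : K} (hΛ : ∀ x, x * Λ = ε x • Λ) (h : A) :
    (h ⊗ₜ[k] (1 : A)) * TensorProduct.map .id S (ΔAB Λ)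
      = TensorProduct.map .id S (ΔAB Λ) * ((1 : A) ⊗ₜ[k] h) := by
  let Q (s : A ⊗[k] B) : A ⊗[k] (B ⊗[k] A) →ₗ[k] A ⊗[k] A :=
    LinearMap.mul' k (A ⊗[k] A) ∘ₗ
      TensorProduct.map (TensorProduct.map .id S ∘ₗ LinearMap.mulRight k s)
        (TensorProduct.mk k A A 1) ∘ₗ (TensorProduct.assoc k A B A).symm.toLinearMap
  have Q_add (s t : A ⊗[k] B) (a : A) (u : B ⊗[k] A) :
      Q (s + t) (a ⊗ₜ u) = Q s (a ⊗ₜ u) + Q t (a ⊗ₜ u) := by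
    induction u with
    | zero => simp
    | tmul b c => simp [Q, mul_add, add_mul]
    | add u v hu hv => simp only [TensorProduct.tmul_add, map_add, hu, hv]; abel
  have Q_tmul (a₀ a : A) (b₀ : B) (u : B ⊗[k] A) : Q (a₀ ⊗ₜ b₀) (a ⊗ₜ u)
      = (a * a₀) ⊗ₜ LinearMap.mul' k A (TensorProduct.map S .id (u * (b₀ ⊗ₜ 1))) := by
    induction u with
    | zero => simp
    | tmul b c => simp [Q]
    | add u v hu hv => simp only [TensorProduct.tmul_add, map_add, hu, hv, add_mul]
  have Q_comul (s : A ⊗[k] B) (a : A) (z : K) :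
      Q s (a ⊗ₜ ΔBA z) = ε z • ((a ⊗ₜ 1) * TensorProduct.map .id S s) := by
    induction s with
    | zero => simp [Q]
    | tmul a₀ b₀ => simp [Q_tmul, antipode_mul]
    | add s t hs ht => rw [Q_add, hs, ht, map_add, mul_add, smul_add]
  have left (w : K ⊗[k] A) :
      Q (ΔAB Λ) (TensorProduct.assoc k A B A (TensorProduct.map ΔAB.toLinearMap .id w))
        = TensorProduct.map .id S (ΔAB Λ)
          * (1 ⊗ₜ TensorProduct.lid k A (TensorProduct.map ε.toLinearMap .id w)) := by
    induction w with
    | zero => simp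
    | tmul z c => simp [Q, ← map_mul, hΛ]
    | add s w hs hw => simp only [map_add, hs, hw, TensorProduct.tmul_add, mul_add]
  have right (v : A ⊗[k] K) :
      Q (ΔAB Λ) (TensorProduct.map .id ΔBA.toLinearMap v)
        = (TensorProduct.rid k A (TensorProduct.map .id ε.toLinearMap v) ⊗ₜ 1)
          * TensorProduct.map .id S (ΔAB Λ) := by
    induction v with
    | zero => simp
    | tmul a z => simp [Q_comul, ← TensorProduct.smul_tmul']
    | add s w hs hw => simp only [map_add, hs, hw, TensorProduct.add_tmul, add_mul]
  have key := left (Δ1A h)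
  rw [coassoc, right, counit_left, counit_right] at key
  exact key

end PairOfComponents

namespace HopfGCoalgebra

variable (k : Type*) [Field k] {π : Type*} [Group π] (H : π → Type*)
  [∀ α, Ring (H α)] [∀ α, Algebra k (H α)] [HopfGCoalgebra k H]

/-- The comultiplication `H c → H a ⊗ H b` for `a * b = c`. -/
def comulOfEq {a b c : π} (h : a * b = c) : H c →ₐ[k] H a ⊗[k] H b :=
  (Δ a b).comp (gcast k H h.symm : H c →ₐ[k] H (a * b))

theorem comulOfEq_coassoc {a b c ab bc abc : π} (hab : a * b = ab) (hbc : b * c = bc)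
    (hl : ab * c = abc) (hr : a * bc = abc) (x : H abc) :
    TensorProduct.assoc k (H a) (H b) (H c)
        (TensorProduct.map (comulOfEq k H hab).toLinearMap .id (comulOfEq k H hl x))
      = TensorProduct.map .id (comulOfEq k H hbc).toLinearMap (comulOfEq k H hr x) := by
  subst hab hbc hl
  exact LinearMap.congr_fun (coassoc (k := k) (H := H) a b c) x

theorem antipode_left_comulOfEq (α : π) (x : H 1) :
    LinearMap.mul' k (H α)
        (TensorProduct.map ((gcast k H (inv_inv α)).toLinearMap ∘ₗ S α⁻¹) .id
          (comulOfEq k H (inv_mul_cancel α) x))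
      = algebraMap k (H α) (ε x) := by
  have h := LinearMap.congr_fun (antipode_left (k := k) (H := H) α)
    (gcast k H (inv_mul_cancel α).symm x)
  refine h.trans ?_
  simp [gcast_gcast]

theorem antipode_right_comulOfEq (α : π) (x : H 1) :
    LinearMap.mul' k (H α)
        (TensorProduct.map .id ((gcast k H (inv_inv α)).toLinearMap ∘ₗ S α⁻¹)
          (comulOfEq k H (mul_inv_cancel α) x))
      = algebraMap k (H α) (ε x) := by
  have h := LinearMap.congr_fun (antipode_right (k := k) (H := H) α)
    (gcast k H (mul_inv_cancel α).symm x)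
  refine h.trans ?_
  simp [gcast_gcast]

/-- If `H₁` is semisimple, then so is every `H_α`. -/
theorem isSemisimpleRing_component (k : Type*) [Field k] {π : Type*} [Group π] (H : π → Type*)
    [∀ α, Ring (H α)] [∀ α, Algebra k (H α)] [HopfGCoalgebra k H]
    [IsSemisimpleRing (H 1)] (α : π) :
    IsSemisimpleRing (H α) := by
  obtain ⟨Λ, hΛ, hΛ_one⟩ := IsSemisimpleRing.exists_left_integral (ε (k := k) (H := H))
  have counit_left' (β : π) (x : H β) := LinearMap.congr_fun (counit_left (k := k) (H := H) β) x
  have counit_right' (β : π) (x : H β) := LinearMap.congr_fun (counit_right (k := k) (H := H) β) x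
  have antipode_mul := antipode_mul_left
    (Δ1B := (comulOfEq k H (one_mul α⁻¹)).toLinearMap)
    (ΔB1 := (comulOfEq k H (mul_one α⁻¹)).toLinearMap)
    (comulOfEq_coassoc k H (inv_mul_cancel α) (mul_inv_cancel α) (one_mul α⁻¹) (mul_one α⁻¹))
    (counit_left' α⁻¹) (counit_right' α⁻¹)
    (antipode_left_comulOfEq k H α) (antipode_right_comulOfEq k H α)
  refine IsSemisimpleRing.of_separability_element _
    (integral_antipode_balanced
      (Δ1A := (comulOfEq k H (one_mul α)).toLinearMap)
      (ΔA1 := (comulOfEq k H (mul_one α)).toLinearMap)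
      (comulOfEq_coassoc k H (mul_inv_cancel α) (inv_mul_cancel α) (one_mul α) (mul_one α))
      (counit_left' α) (counit_right' α) antipode_mul hΛ) ?_
  rw [antipode_right_comulOfEq, hΛ_one, map_one]

end HopfGCoalgebra

/-- Lemma 5.1: a finite dimensional Hopf `π`-coalgebra is semisimple (each `H_α` is a
semisimple algebra) if and only if `H₁` is semisimple. -/
theorem semisimple_iff_component_one (k : Type*) [Field k] {π : Type*} [Group π]
    (H : π → Type*) [∀ α, Ring (H α)] [∀ α, Algebra k (H α)] [HopfGCoalgebra k H]
    [∀ α, FiniteDimensional k (H α)] :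
    (∀ α : π, IsSemisimpleRing (H α)) ↔ IsSemisimpleRing (H 1) := by
  exact ⟨fun h ↦ h 1, fun _ α ↦ isSemisimpleRing_component k H α⟩
end
end

section
/- Let H be a Hopf π-coalgebra over a field k. The following conditions are equivalent: (i) H is cosemisimple; (ii) there exists a right π-integral λ = (λ_α)_{α∈π} for H with λ_α(1_α) = 1 for some α ∈ π; (iii) there exists a right π-integral λ = (λ_α)_{α∈π} for H with λ_α(1_α) = 1 for every α ∈ π with H_α ≠ 0. -/
open scoped TensorProduct

noncomputable section

open HopfGCoalgebra
open CrossedHopfGCoalgebra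

open QTHopfGCoalgebra

section TensorContraction

variable {k : Type*} [Field k] {V W : Type*} [AddCommGroup V] [Module k V]
  [AddCommGroup W] [Module k W]

/-- Contraction of the right tensor factor against a linear form. -/
def sliceRight (V : Type*) [AddCommGroup V] [Module k V] (f : W →ₗ[k] k) :
    V ⊗[k] W →ₗ[k] V :=
  (TensorProduct.rid k V).toLinearMap ∘ₗ TensorProduct.map LinearMap.id f

/-- Contraction of the left tensor factor against a linear form. -/
def sliceLeft (W : Type*) [AddCommGroup W] [Module k W] (f : V →ₗ[k] k) :
    V ⊗[k] W →ₗ[k] W :=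
  (TensorProduct.lid k W).toLinearMap ∘ₗ TensorProduct.map f LinearMap.id

@[simp]
theorem sliceRight_tmul (f : W →ₗ[k] k) (v : V) (w : W) :
    sliceRight V f (v ⊗ₜ[k] w) = f w • v := by
  simp [sliceRight]

@[simp]
theorem sliceLeft_tmul (f : V →ₗ[k] k) (v : V) (w : W) :
    sliceLeft W f (v ⊗ₜ[k] w) = f v • w := by
  simp [sliceLeft]

theorem eq_zero_of_sliceRight_eq_zero {t : V ⊗[k] W}
    (h : ∀ f : W →ₗ[k] k, sliceRight V f t = 0) : t = 0 := by
  classical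
  let b := Module.Basis.ofVectorSpace k W
  refine (TensorProduct.equivFinsuppOfBasisRight (M := V) b).injective ?_
  ext i
  rw [TensorProduct.equivFinsuppOfBasisRight_apply, map_zero]
  exact h (b.coord i)

theorem sliceRight_map {V' : Type*} [AddCommGroup V'] [Module k V'] (g : V →ₗ[k] V')
    (f : W →ₗ[k] k) (t : V ⊗[k] W) :
    sliceRight V' f (TensorProduct.map g LinearMap.id t) = g (sliceRight V f t) := by
  induction t using TensorProduct.induction_on with
  | zero => simp
  | tmul v w => simp
  | add s t hs ht => simp only [map_add, hs, ht]

/-- Over a field, an element of `V ⊗ W` lies in `N ⊗ W` iff all its contractions lie in `N`. -/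
theorem mem_range_map_subtype_iff (N : Submodule k V) (t : V ⊗[k] W) :
    t ∈ LinearMap.range (TensorProduct.map N.subtype (LinearMap.id : W →ₗ[k] W)) ↔
      ∀ f : W →ₗ[k] k, sliceRight V f t ∈ N := by
  constructor
  · rintro ⟨s, rfl⟩ f
    rw [sliceRight_map]
    exact Subtype.prop _
  · intro h
    change t ∈ LinearMap.range (LinearMap.rTensor W N.subtype)
    rw [← rTensor_mkQ, LinearMap.mem_ker]
    refine eq_zero_of_sliceRight_eq_zero fun f => ?_
    rw [LinearMap.rTensor, sliceRight_map, Submodule.mkQ_apply, Submodule.Quotient.mk_eq_zero]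
    exact h f

end TensorContraction

section SubcomoduleLattice

variable {k : Type*} [Field k] {π : Type*} [Group π] {H : π → Type*}
  [∀ α, Ring (H α)] [∀ α, Algebra k (H α)]
  {M : π → Type*} [∀ α, AddCommGroup (M α)] [∀ α, Module k (M α)]
  (ρ : ∀ α β : π, M (α * β) →ₗ[k] M α ⊗[k] H β)

theorem isGSubcomodule_iff (N : ∀ α, Submodule k (M α)) :
    IsGSubcomodule k H M ρ N ↔ ∀ (α β : π) (f : H β →ₗ[k] k),
      N (α * β) ≤ (N α).comap (sliceRight (M α) f ∘ₗ ρ α β) := by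
  simp only [IsGSubcomodule, mem_range_map_subtype_iff]
  exact ⟨fun h α β f x hx => h α β x hx f, fun h α β x hx f => h α β f hx⟩

/-- The complete lattice of `π`-subcomodules. -/
def subcomodules : CompleteSublattice (∀ α, Submodule k (M α)) :=
  CompleteSublattice.mk' {N | IsGSubcomodule k H M ρ N}
    (by
      intro s hs
      refine (isGSubcomodule_iff ρ _).2 fun α β f => ?_
      rw [sSup_apply, iSup_le_iff]
      intro N
      refine ((isGSubcomodule_iff ρ _).1 (hs N.2) α β f).trans (Submodule.comap_mono ?_)
      rw [sSup_apply]
      exact le_iSup (fun N : s => N.1 α) N)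
    (by
      intro s hs
      refine (isGSubcomodule_iff ρ _).2 fun α β f => ?_
      rw [sInf_apply, sInf_apply, Submodule.comap_iInf, le_iInf_iff]
      intro N
      exact (iInf_le (fun N : s => N.1 (α * β)) N).trans
        ((isGSubcomodule_iff ρ _).1 (hs N.2) α β f))

theorem mem_subcomodules {N : ∀ α, Submodule k (M α)} :
    N ∈ subcomodules ρ ↔ IsGSubcomodule k H M ρ N := Iff.rfl

instance : IsModularLattice (subcomodules ρ) where
  sup_inf_le_assoc_of_le P _ h α :=
    IsModularLattice.sup_inf_le_assoc_of_le (P.1 α) (h α)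

theorem sSup_subcomodules_apply (s : Set (subcomodules ρ)) (α : π) :
    (sSup s).1 α = ⨆ N : s, N.1.1 α := by
  rw [sSup_eq_iSup', CompleteSublattice.coe_iSup, iSup_apply]

/-- The `π`-subcomodule generated by a homogeneous element. -/
def subcomoduleSpan {α : π} (x : M α) : subcomodules ρ :=
  sInf {N | x ∈ N.1 α}

theorem subcomoduleSpan_le_iff {α : π} {x : M α} {N : subcomodules ρ} :
    subcomoduleSpan ρ x ≤ N ↔ x ∈ N.1 α := by
  refine ⟨fun h => h α ?_, fun h => sInf_le h⟩
  rw [subcomoduleSpan, sInf_eq_iInf', CompleteSublattice.coe_iInf, iInf_apply,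
    Submodule.mem_iInf]
  exact fun N => N.2

theorem isCompactElement_subcomoduleSpan {α : π} (x : M α) :
    IsCompactElement (subcomoduleSpan ρ x) := by
  rw [CompleteLattice.isCompactElement_iff_le_of_directed_sSup_le]
  intro s hs hdir hx
  rw [subcomoduleSpan_le_iff, sSup_subcomodules_apply] at hx
  have : Nonempty s := hs.to_subtype
  have hd : Directed (· ≤ ·) fun N : s => N.1.1 α := by
    intro N P
    obtain ⟨Q, hQ, hNQ, hPQ⟩ := hdir N.1 N.2 P.1 P.2
    exact ⟨⟨Q, hQ⟩, hNQ α, hPQ α⟩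
  obtain ⟨N, hN⟩ := (Submodule.mem_iSup_of_directed _ hd).1 hx
  exact ⟨N.1, N.2, (subcomoduleSpan_le_iff ρ).2 hN⟩

instance : IsCompactlyGenerated (subcomodules ρ) where
  exists_sSup_eq N := by
    refine ⟨{P | (∃ (α : π) (x : M α), P = subcomoduleSpan ρ x) ∧ P ≤ N}, ?_, ?_⟩
    · rintro _ ⟨⟨α, x, rfl⟩, -⟩
      exact isCompactElement_subcomoduleSpan ρ x
    · refine le_antisymm (sSup_le fun P hP => hP.2) fun α x hx => ?_
      exact (subcomoduleSpan_le_iff ρ).1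
        (le_sSup ⟨⟨α, x, rfl⟩, (subcomoduleSpan_le_iff ρ).2 hx⟩)

theorem isAtom_subcomodules_iff (N : subcomodules ρ) :
    IsAtom N ↔ IsSimpleGSubcomodule k H M ρ N.1 := by
  have hbot (P : subcomodules ρ) : P = ⊥ ↔ ∀ α, P.1 α = ⊥ := by
    rw [Subtype.ext_iff, CompleteSublattice.coe_bot, funext_iff]
    rfl
  constructor
  · intro h
    refine ⟨N.2, by simpa using (hbot N).not.1 h.1, fun P hP hPN => ?_⟩
    rcases h.le_iff.1 (show (⟨P, hP⟩ : subcomodules ρ) ≤ N from hPN) with h0 | h1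
    · exact Or.inl ((hbot _).1 h0)
    · exact Or.inr (congrArg Subtype.val h1)
  · rintro ⟨-, ⟨α, hα⟩, hN⟩
    refine ⟨fun h => hα ((hbot N).1 h α), fun P hP => ?_⟩
    rcases hN P.1 P.2 hP.le with h0 | h1
    · exact (hbot P).2 h0
    · exact absurd (Subtype.ext h1) hP.ne

/-- A `π`-comodule is cosemisimple iff each of its `π`-subcomodules has a complement. -/
theorem isGCosemisimple_iff_complementedLattice :
    IsGCosemisimple k H M ρ ↔ ComplementedLattice (subcomodules ρ) := by
  have key : IsGCosemisimple k H M ρ ↔ sSup {N : subcomodules ρ | IsAtom N} = ⊤ := by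
    rw [Subtype.ext_iff, funext_iff]
    refine forall_congr' fun α => ?_
    rw [sSup_subcomodules_apply]
    have : (⨆ N : {N // IsSimpleGSubcomodule k H M ρ N}, N.1 α) =
        ⨆ N : {N : subcomodules ρ | IsAtom N}, N.1.1 α :=
      le_antisymm
        (iSup_le fun N => le_iSup (fun N : {N : subcomodules ρ | IsAtom N} => N.1.1 α)
          ⟨⟨N.1, N.2.1⟩, (isAtom_subcomodules_iff ρ _).2 N.2⟩)
        (iSup_le fun N => le_iSup (fun N : {N // IsSimpleGSubcomodule k H M ρ N} => N.1 α)
          ⟨N.1.1, (isAtom_subcomodules_iff ρ _).1 N.2⟩)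
    rw [this]
    rfl
  rw [key]
  exact ⟨complementedLattice_of_sSup_atoms_eq_top, fun _ => sSup_atoms_eq_top⟩

end SubcomoduleLattice

theorem sliceLeft_tmul_one_mul {k A B : Type*} [Field k] [Ring A] [Algebra k A] [Ring B]
    [Algebra k B] (f : A →ₗ[k] k) (a : A) (t : A ⊗[k] B) :
    sliceLeft B f ((a ⊗ₜ[k] 1) * t) = sliceLeft B (f ∘ₗ LinearMap.mulLeft k a) t := by
  induction t using TensorProduct.induction_on with
  | zero => simp
  | tmul u v => simp
  | add s t hs ht => simp only [mul_add, map_add, hs, ht]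

theorem sliceLeft_one_tmul_mul {k A B : Type*} [Field k] [Ring A] [Algebra k A] [Ring B]
    [Algebra k B] (f : A →ₗ[k] k) (b : B) (t : A ⊗[k] B) :
    sliceLeft B f ((1 ⊗ₜ[k] b) * t) = b * sliceLeft B f t := by
  induction t using TensorProduct.induction_on with
  | zero => simp
  | tmul u v => simp
  | add s t hs ht => simp only [mul_add, map_add, hs, ht]

namespace HopfGCoalgebra

open TensorProduct

variable {k : Type*} [Field k] {π : Type*} [Group π] {H : π → Type*}
  [∀ α, Ring (H α)] [∀ α, Algebra k (H α)] [HopfGCoalgebra k H]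

variable (k H) in
/-- The comultiplication `H c → H a ⊗ H b` for any factorization `a * b = c`. -/
def comulAt {a b c : π} (h : a * b = c) : H c →ₐ[k] H a ⊗[k] H b :=
  (Δ a b).comp (gcast k H h.symm).toAlgHom

variable (k H) in
/-- The antipode `H a → H b` for mutually inverse `a` and `b`. -/
def antipodeAt {a b : π} (h : a * b = 1) : H a →ₗ[k] H b :=
  (gcast k H (inv_eq_of_mul_eq_one_right h)).toLinearMap ∘ₗ S a

theorem comulAt_coassoc {a b c ab bc abc : π} (hab : a * b = ab) (hbc : b * c = bc)
    (h : ab * c = abc) (h' : a * bc = abc) (x : H abc) :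
    TensorProduct.assoc k (H a) (H b) (H c)
        (map (comulAt k H hab).toLinearMap LinearMap.id (comulAt k H h x)) =
      map LinearMap.id (comulAt k H hbc).toLinearMap (comulAt k H h' x) := by
  subst hab hbc h
  exact LinearMap.congr_fun (coassoc (k := k) (H := H) a b c) x

theorem comulAt_counit_right {a : π} (h : a * 1 = a) (x : H a) :
    sliceRight (H a) (counit k H).toLinearMap (comulAt k H h x) = x :=
  LinearMap.congr_fun (counit_right (k := k) (H := H) a) x

theorem comulAt_counit_left {a : π} (h : 1 * a = a) (x : H a) :
    sliceLeft (H a) (counit k H).toLinearMap (comulAt k H h x) = x :=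
  LinearMap.congr_fun (counit_left (k := k) (H := H) a) x

theorem antipodeAt_mul {a b : π} (h : a * b = 1) (x : H 1) :
    LinearMap.mul' k (H b) (map (antipodeAt k H h) LinearMap.id (comulAt k H h x)) =
      counit k H x • 1 := by
  obtain rfl := eq_inv_of_mul_eq_one_left h
  refine (LinearMap.congr_fun (antipode_left (k := k) (H := H) b)
    (gcast k H h.symm x)).trans ?_
  simp [gcast_gcast, Algebra.algebraMap_eq_smul_one, counit]

theorem mul_antipodeAt {a b : π} (h : a * b = 1) (h' : b * a = 1) (x : H 1) :
    LinearMap.mul' k (H b) (map LinearMap.id (antipodeAt k H h) (comulAt k H h' x)) =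
      counit k H x • 1 := by
  obtain rfl := eq_inv_of_mul_eq_one_left h
  refine (LinearMap.congr_fun (antipode_right (k := k) (H := H) b)
    (gcast k H h'.symm x)).trans ?_
  simp [gcast_gcast, Algebra.algebraMap_eq_smul_one, counit]

/-- The identity `(S(v₁) ⊗ 1) Δ(v₂) = 1 ⊗ v`. -/
theorem antipodeAt_tmul_one_mul_comulAt {a b c e : π} (hab : a * b = c) (hea : e * a = 1)
    (hec : e * c = b) (v : H b) :
    LinearMap.mul' k (H a ⊗[k] H b)
        (map ((Algebra.TensorProduct.includeLeft (R := k) (S := k) (A := H a)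
            (B := H b)).toLinearMap ∘ₗ antipodeAt k H hea)
          (comulAt k H hab).toLinearMap (comulAt k H hec v)) = 1 ⊗ₜ[k] v := by
  set ι : H e →ₗ[k] H a ⊗[k] H b := (Algebra.TensorProduct.includeLeft (R := k) (S := k)
    (A := H a) (B := H b)).toLinearMap ∘ₗ antipodeAt k H hea with hι
  have pull (t : H e ⊗[k] H a) (w : H b) :
      LinearMap.mul' k (H a ⊗[k] H b)
          (map ι LinearMap.id (TensorProduct.assoc k _ _ _ (t ⊗ₜ[k] w))) =
        LinearMap.mul' k (H a) (map (antipodeAt k H hea) LinearMap.id t) ⊗ₜ[k] w := by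
    induction t using TensorProduct.induction_on with
    | zero => simp
    | tmul p q => simp [hι]
    | add s t hs ht => simp only [add_tmul, map_add, hs, ht]
  have collapse (s : H 1 ⊗[k] H b) :
      LinearMap.mul' k (H a ⊗[k] H b) (map ι LinearMap.id (TensorProduct.assoc k _ _ _
          (map (comulAt k H hea).toLinearMap LinearMap.id s))) =
        1 ⊗ₜ[k] sliceLeft (H b) (counit k H).toLinearMap s := by
    induction s using TensorProduct.induction_on with
    | zero => simp
    | tmul w v =>
      rw [map_tmul, pull, AlgHom.toLinearMap_apply, antipodeAt_mul]
      simp [smul_tmul]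
    | add s t hs ht => simp only [map_add, hs, ht, tmul_add]
  have h := collapse (comulAt k H (one_mul b) v)
  rw [comulAt_counit_left, comulAt_coassoc hea hab (one_mul b) hec] at h
  rw [← h, ← LinearMap.comp_apply (map ι LinearMap.id), ← map_comp]
  rfl

/-- The identity `(1 ⊗ y₁) Δ(S(y₂)) = S(y) ⊗ 1`. -/
theorem one_tmul_mul_comulAt_antipodeAt {a b c d e : π} (hab : a * b = c) (hcd : c * d = 1)
    (hdc : d * c = 1) (hea : e * a = 1) (hbd : b * d = e) (y : H e) :
    LinearMap.mul' k (H a ⊗[k] H b)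
        (map (Algebra.TensorProduct.includeRight (R := k) (A := H a) (B := H b)).toLinearMap
          ((comulAt k H hab).toLinearMap ∘ₗ antipodeAt k H hdc) (comulAt k H hbd y)) =
      antipodeAt k H hea y ⊗ₜ[k] 1 := by
  have hec : e * c = b := by rw [← hab, ← mul_assoc, hea, one_mul]
  set D := (comulAt k H hab).toLinearMap with hD
  set ι : H e →ₗ[k] H a ⊗[k] H b := (Algebra.TensorProduct.includeLeft (R := k) (S := k)
    (A := H a) (B := H b)).toLinearMap ∘ₗ antipodeAt k H hea with hι
  set Φ : H e ⊗[k] (H c ⊗[k] H d) →ₗ[k] H a ⊗[k] H b := LinearMap.mul' k _ ∘ₗ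
    map ι (LinearMap.mul' k _ ∘ₗ map D (D ∘ₗ antipodeAt k H hdc)) with hΦ
  have pull (t : H e ⊗[k] H c) (w : H d) :
      Φ (TensorProduct.assoc k _ _ _ (t ⊗ₜ[k] w)) =
        LinearMap.mul' k _ (map ι D t) * D (antipodeAt k H hdc w) := by
    induction t using TensorProduct.induction_on with
    | zero => simp
    | tmul p q => simp [hΦ, mul_assoc]
    | add s t hs ht => simp only [add_tmul, map_add, hs, ht, add_mul]
  have left (s : H b ⊗[k] H d) :
      Φ (TensorProduct.assoc k _ _ _ (map (comulAt k H hec).toLinearMap LinearMap.id s)) =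
        LinearMap.mul' k _ (map (Algebra.TensorProduct.includeRight (R := k) (A := H a)
          (B := H b)).toLinearMap (D ∘ₗ antipodeAt k H hdc) s) := by
    induction s using TensorProduct.induction_on with
    | zero => simp
    | tmul v w =>
      rw [map_tmul, pull, AlgHom.toLinearMap_apply, antipodeAt_tmul_one_mul_comulAt]
      simp
    | add s t hs ht => simp only [map_add, hs, ht]
  have mulD (t : H c ⊗[k] H d) :
      LinearMap.mul' k _ (map D (D ∘ₗ antipodeAt k H hdc) t) =
        D (LinearMap.mul' k _ (map LinearMap.id (antipodeAt k H hdc) t)) := by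
    induction t using TensorProduct.induction_on with
    | zero => simp
    | tmul p q => simp [hD]
    | add s t hs ht => simp only [map_add, hs, ht]
  have right (s : H e ⊗[k] H 1) :
      Φ (map LinearMap.id (comulAt k H hcd).toLinearMap s) =
        ι (sliceRight (H e) (counit k H).toLinearMap s) := by
    induction s using TensorProduct.induction_on with
    | zero => simp
    | tmul u w =>
      have hw : LinearMap.mul' k _ (map D (D ∘ₗ antipodeAt k H hdc) (comulAt k H hcd w)) =
          counit k H w • 1 := by
        rw [mulD, mul_antipodeAt]
        simp [hD]
      simp [hΦ, hw]
    | add s t hs ht => simp only [map_add, hs, ht]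
  rw [← left, comulAt_coassoc hec hcd hbd (mul_one e), right, comulAt_counit_right]
  rfl

theorem IsRightIntegral.sliceLeft_comulAt {lam : ∀ α : π, H α →ₗ[k] k}
    (hlam : IsRightIntegral k H lam) {a b c : π} (h : a * b = c) (x : H c) :
    sliceLeft (H b) (lam a) (comulAt k H h x) = lam c x • 1 := by
  subst h
  exact hlam a b x

/-- The pairing `(y, x) ↦ λ(S(y) x)`. -/
def antipodePairing (lam : ∀ α : π, H α →ₗ[k] k) {c d : π} (hdc : d * c = 1) :
    H d →ₗ[k] H c →ₗ[k] k :=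
  (LinearMap.mul k (H c)).compr₂ (lam c) ∘ₗ antipodeAt k H hdc

theorem antipodePairing_apply (lam : ∀ α : π, H α →ₗ[k] k) {c d : π} (hdc : d * c = 1)
    (y : H d) (x : H c) :
    antipodePairing lam hdc y x = lam c (antipodeAt k H hdc y * x) := rfl

/-- The identity `λ(S(y₂) x) y₁ = λ(S(y) x₁) x₂` for a right `π`-integral `λ`. -/
theorem IsRightIntegral.sliceRight_antipodePairing {lam : ∀ α : π, H α →ₗ[k] k}
    (hlam : IsRightIntegral k H lam) {a b c d e : π} (hab : a * b = c) (hdc : d * c = 1)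
    (hea : e * a = 1) (hbd : b * d = e) (y : H e) (x : H c) :
    sliceRight (H b) ((antipodePairing lam hdc).flip x) (comulAt k H hbd y) =
      sliceLeft (H b) (antipodePairing lam hea y) (comulAt k H hab x) := by
  have hcd : c * d = 1 := mul_eq_one_comm.1 hdc
  have key (s : H b ⊗[k] H d) :
      sliceRight (H b) ((antipodePairing lam hdc).flip x) s =
        sliceLeft (H b) (lam a) (LinearMap.mul' k (H a ⊗[k] H b)
          (map (Algebra.TensorProduct.includeRight (R := k) (A := H a) (B := H b)).toLinearMap
            ((comulAt k H hab).toLinearMap ∘ₗ antipodeAt k H hdc) s) * comulAt k H hab x) := by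
    induction s using TensorProduct.induction_on with
    | zero => simp
    | tmul v w =>
      rw [map_tmul, LinearMap.mul'_apply, mul_assoc, LinearMap.comp_apply,
        AlgHom.toLinearMap_apply, AlgHom.toLinearMap_apply, ← map_mul,
        Algebra.TensorProduct.includeRight_apply, sliceLeft_one_tmul_mul,
        hlam.sliceLeft_comulAt]
      simp [antipodePairing_apply]
    | add s t hs ht => simp only [map_add, add_mul, hs, ht]
  rw [key, one_tmul_mul_comulAt_antipodeAt hab hcd hdc hea hbd, sliceLeft_tmul_one_mul]
  rfl


/-- The map `n ⊗ y ⊗ x ↦ λ(S(y) x) n`. -/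
def pairTail (lam : ∀ α : π, H α →ₗ[k] k) {c d : π} (hdc : d * c = 1) :
    (H c ⊗[k] H d) ⊗[k] H c →ₗ[k] H c :=
  (TensorProduct.rid k (H c)).toLinearMap ∘ₗ
    map LinearMap.id (lift (antipodePairing lam hdc)) ∘ₗ
    (TensorProduct.assoc k (H c) (H d) (H c)).toLinearMap

theorem pairTail_tmul (lam : ∀ α : π, H α →ₗ[k] k) {c d : π} (hdc : d * c = 1)
    (t : H c ⊗[k] H d) (x : H c) :
    pairTail lam hdc (t ⊗ₜ[k] x) =
      sliceRight (H c) ((antipodePairing lam hdc).flip x) t := by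
  induction t using TensorProduct.induction_on with
  | zero => simp
  | tmul u y => simp [pairTail]
  | add s t hs ht => simp only [add_tmul, map_add, hs, ht]

/-- The map `n ⊗ x ↦ λ(S(n₂) x) n₁`. -/
def coactPairing (lam : ∀ α : π, H α →ₗ[k] k) (c : π) : H 1 ⊗[k] H c →ₗ[k] H c :=
  pairTail lam (inv_mul_cancel c) ∘ₗ
    map (comulAt k H (mul_inv_cancel c)).toLinearMap LinearMap.id

theorem coactPairing_tmul (lam : ∀ α : π, H α →ₗ[k] k) {c : π} (n : H 1) (x : H c) :
    coactPairing lam c (n ⊗ₜ[k] x) =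
      sliceRight (H c) ((antipodePairing lam (inv_mul_cancel c)).flip x)
        (comulAt k H (mul_inv_cancel c) n) := by
  simp [coactPairing, pairTail_tmul]

theorem IsRightIntegral.comulAt_coactPairing {lam : ∀ α : π, H α →ₗ[k] k}
    (hlam : IsRightIntegral k H lam) {a b c : π} (hab : a * b = c) (n : H 1) (x : H c) :
    comulAt k H hab (coactPairing lam c (n ⊗ₜ[k] x)) =
      map (coactPairing lam a) LinearMap.id
        ((TensorProduct.assoc k _ _ _).symm (n ⊗ₜ[k] comulAt k H hab x)) := by
  have hbd : b * c⁻¹ = a⁻¹ := by rw [← hab, mul_inv_rev, mul_inv_cancel_left]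
  set f := (antipodePairing lam (inv_mul_cancel c)).flip x
  have push (t : H c ⊗[k] H c⁻¹) :
      comulAt k H hab (sliceRight (H c) f t) =
        map LinearMap.id (sliceRight (H b) f) (TensorProduct.assoc k _ _ _
          (map (comulAt k H hab).toLinearMap LinearMap.id t)) := by
    induction t using TensorProduct.induction_on with
    | zero => simp
    | tmul u y =>
      simp only [sliceRight_tmul, map_smul, map_tmul, AlgHom.toLinearMap_apply]
      induction comulAt k H hab u using TensorProduct.induction_on with
      | zero => simp
      | tmul p q => simp
      | add s t hs ht => simp only [add_tmul, smul_add, map_add, hs, ht]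
    | add s t hs ht => simp only [map_add, hs, ht]
  have pull (u : H a) (y : H a⁻¹) (s : H a ⊗[k] H b) :
      map (pairTail lam (inv_mul_cancel a)) LinearMap.id
          ((TensorProduct.assoc k _ _ _).symm ((u ⊗ₜ[k] y) ⊗ₜ[k] s)) =
        u ⊗ₜ[k] sliceLeft (H b) (antipodePairing lam (inv_mul_cancel a) y) s := by
    induction s using TensorProduct.induction_on with
    | zero => simp
    | tmul p q => simp [pairTail_tmul, smul_tmul]
    | add s t hs ht => simp only [tmul_add, map_add, hs, ht]
  have swap (t : H a ⊗[k] H a⁻¹) :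
      map LinearMap.id (sliceRight (H b) f) (map LinearMap.id (comulAt k H hbd).toLinearMap t) =
        map (pairTail lam (inv_mul_cancel a)) LinearMap.id
          ((TensorProduct.assoc k _ _ _).symm (t ⊗ₜ[k] comulAt k H hab x)) := by
    induction t using TensorProduct.induction_on with
    | zero => simp
    | tmul u y =>
      rw [pull, map_tmul, map_tmul, AlgHom.toLinearMap_apply,
        hlam.sliceRight_antipodePairing hab (inv_mul_cancel c) (inv_mul_cancel a) hbd]
      rfl
    | add s t hs ht => simp only [add_tmul, map_add, hs, ht]
  have unfold_right (s : H a ⊗[k] H b) :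
      map (coactPairing lam a) LinearMap.id ((TensorProduct.assoc k _ _ _).symm (n ⊗ₜ[k] s)) =
        map (pairTail lam (inv_mul_cancel a)) LinearMap.id
          ((TensorProduct.assoc k _ _ _).symm (comulAt k H (mul_inv_cancel a) n ⊗ₜ[k] s)) := by
    induction s using TensorProduct.induction_on with
    | zero => simp
    | tmul p q => simp [coactPairing]
    | add s t hs ht => simp only [tmul_add, map_add, hs, ht]
  rw [coactPairing_tmul, push,
    comulAt_coassoc hab hbd (mul_inv_cancel c) (mul_inv_cancel a), swap, unfold_right]

/-- The average of a linear endomorphism `p` of `H 1` with respect to `λ`. -/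
def average (lam : ∀ α : π, H α →ₗ[k] k) (p : H (1 : π) →ₗ[k] H (1 : π)) (c : π) :
    H c →ₗ[k] H c :=
  coactPairing lam c ∘ₗ map p LinearMap.id ∘ₗ (comulAt k H (one_mul c)).toLinearMap

/-- The average with respect to a right `π`-integral is a map of `π`-comodules. -/
theorem IsRightIntegral.comulAt_average {lam : ∀ α : π, H α →ₗ[k] k}
    (hlam : IsRightIntegral k H lam) (p : H (1 : π) →ₗ[k] H (1 : π)) {a b c : π}
    (hab : a * b = c) (x : H c) :
    comulAt k H hab (average lam p c x) =
      map (average lam p a) LinearMap.id (comulAt k H hab x) := by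
  have push (s : H 1 ⊗[k] H c) :
      comulAt k H hab (coactPairing lam c (map p LinearMap.id s)) =
        map (coactPairing lam a ∘ₗ map p LinearMap.id) LinearMap.id
          ((TensorProduct.assoc k _ _ _).symm
            (map LinearMap.id (comulAt k H hab).toLinearMap s)) := by
    induction s using TensorProduct.induction_on with
    | zero => simp
    | tmul n x =>
      rw [map_tmul, map_tmul, LinearMap.id_apply, LinearMap.id_apply, hlam.comulAt_coactPairing,
        AlgHom.toLinearMap_apply]
      induction comulAt k H hab x using TensorProduct.induction_on with
      | zero => simp
      | tmul p q => simp
      | add s t hs ht => simp only [tmul_add, map_add, hs, ht]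
    | add s t hs ht => simp only [map_add, hs, ht]
  rw [average, LinearMap.comp_apply, LinearMap.comp_apply, push, AlgHom.toLinearMap_apply,
    ← comulAt_coassoc (one_mul a) hab hab (one_mul c), LinearEquiv.symm_apply_apply,
    ← LinearMap.comp_apply, ← map_comp]
  rfl

theorem coactPairing_comulAt {lam : ∀ α : π, H α →ₗ[k] k} {c : π} (hc : lam c 1 = 1) (x : H c) :
    coactPairing lam c (comulAt k H (one_mul c) x) = x := by
  have hpair (t : H c⁻¹ ⊗[k] H c) :
      lift (antipodePairing lam (inv_mul_cancel c)) t =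
        lam c (LinearMap.mul' k _ (map (antipodeAt k H (inv_mul_cancel c)) LinearMap.id t)) := by
    induction t using TensorProduct.induction_on with
    | zero => simp
    | tmul p q => simp [antipodePairing_apply]
    | add s t hs ht => simp only [map_add, hs, ht]
  have hslice (s : H c ⊗[k] H 1) :
      TensorProduct.rid k (H c) (map LinearMap.id (lift (antipodePairing lam (inv_mul_cancel c)))
          (map LinearMap.id (comulAt k H (inv_mul_cancel c)).toLinearMap s)) =
        sliceRight (H c) (counit k H).toLinearMap s := by
    induction s using TensorProduct.induction_on with
    | zero => simp
    | tmul u w => simp [hpair, antipodeAt_mul, hc]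
    | add s t hs ht => simp only [map_add, hs, ht]
  have h := hslice (comulAt k H (mul_one c) x)
  rw [comulAt_counit_right, ← comulAt_coassoc (mul_inv_cancel c) (inv_mul_cancel c) (one_mul c)
    (mul_one c)] at h
  exact h

variable (k H) in
/-- The lattice of `π`-subcomodules of `H`. -/
abbrev subcoideals : CompleteSublattice (∀ α, Submodule k (H α)) :=
  subcomodules fun α β => (comul k H α β).toLinearMap

theorem sliceRight_comulAt_mem {N : ∀ α, Submodule k (H α)} (hN : N ∈ subcoideals k H)
    {a b c : π} (h : a * b = c) (f : H b →ₗ[k] k) {x : H c} (hx : x ∈ N c) :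
    sliceRight (H a) f (comulAt k H h x) ∈ N a := by
  subst h
  exact (isGSubcomodule_iff _ _).1 hN a b f hx

theorem exists_isCompl_of_integral {lam : ∀ α : π, H α →ₗ[k] k}
    (hlam : IsRightIntegral k H lam) (hone : ∀ α, Nontrivial (H α) → lam α 1 = 1)
    {N : ∀ α, Submodule k (H α)} (hN : N ∈ subcoideals k H) :
    ∃ P ∈ subcoideals k H, IsCompl N P := by
  obtain ⟨q, hq⟩ := (N 1).subtype.exists_leftInverse_of_injective (N 1).ker_subtype
  set p : H (1 : π) →ₗ[k] H (1 : π) := (N 1).subtype ∘ₗ q with hp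
  have hpN (n : N 1) : p n = n := congrArg Subtype.val (LinearMap.congr_fun hq n)
  have hmem (c : π) (x : H c) : average lam p c x ∈ N c := by
    change coactPairing lam c (map p LinearMap.id (comulAt k H (one_mul c) x)) ∈ N c
    induction comulAt k H (one_mul c) x using TensorProduct.induction_on with
    | zero => simp
    | tmul n x =>
      rw [map_tmul, coactPairing_tmul]
      exact sliceRight_comulAt_mem hN _ _ (q n).2
    | add s t hs ht =>
      simp only [map_add]
      exact add_mem hs ht
  have hfix (c : π) (x : N c) : average lam p c x = x := by
    rcases subsingleton_or_nontrivial (H c) with _ | hc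
    · exact Subsingleton.elim _ _
    obtain ⟨s, hs⟩ := (mem_range_map_subtype_iff (N 1) (comulAt k H (one_mul c) x.1)).2
      fun f => sliceRight_comulAt_mem hN (one_mul c) f x.2
    have hps : map p LinearMap.id (comulAt k H (one_mul c) x.1) =
        comulAt k H (one_mul c) x.1 := by
      rw [← hs, ← LinearMap.comp_apply, ← map_comp]
      congr 2
      exact LinearMap.ext hpN
    change coactPairing lam c (map p LinearMap.id (comulAt k H (one_mul c) x.1)) = x
    rw [hps, coactPairing_comulAt (hone c hc)]
  refine ⟨fun c => LinearMap.ker (average lam p c), ?_, ?_⟩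
  · rw [mem_subcomodules, isGSubcomodule_iff]
    intro a b f x hx
    have h := hlam.comulAt_average p (rfl : a * b = a * b) x
    rw [LinearMap.mem_ker.1 hx, map_zero] at h
    change average lam p a (sliceRight (H a) f (comulAt k H rfl x)) = 0
    rw [← sliceRight_map, ← h, map_zero]
  · rw [Pi.isCompl_iff]
    intro c
    have := LinearMap.isCompl_of_proj (p := N c) (f := (average lam p c).codRestrict (N c) (hmem c))
      fun x => Subtype.ext (hfix c x)
    rwa [LinearMap.ker_codRestrict] at this

theorem nontrivial_of_mul_eq_one (k : Type*) [Field k] {π : Type*} [Group π]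
    (H : π → Type*) [∀ α, Ring (H α)] [∀ α, Algebra k (H α)] [HopfGCoalgebra k H]
    {a b : π} (h : a * b = 1) [Nontrivial (H b)] :
    Nontrivial (H a) := by
  rw [← not_subsingleton_iff_nontrivial]
  intro
  have : Subsingleton (H a ⊗[k] H b) := inferInstance
  have e := antipodeAt_mul (k := k) (H := H) h 1
  rw [Subsingleton.elim (comulAt k H h 1) 0] at e
  simp at e

theorem nontrivial_of_mul_eq (k : Type*) [Field k] {π : Type*} [Group π]
    (H : π → Type*) [∀ α, Ring (H α)] [∀ α, Algebra k (H α)] [HopfGCoalgebra k H]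
    {a b c : π} (h : a * b = c) [Nontrivial (H b)]
    [Nontrivial (H c)] : Nontrivial (H a) := by
  have : Nontrivial (H b⁻¹) := nontrivial_of_mul_eq_one k H (inv_mul_cancel b)
  have h' : c * b⁻¹ = a := by rw [← h, mul_inv_cancel_right]
  exact (comulAt k H h').toRingHom.domain_nontrivial

theorem nontrivial_one (k : Type*) [Field k] {π : Type*} [Group π]
    (H : π → Type*) [∀ α, Ring (H α)] [∀ α, Algebra k (H α)] [HopfGCoalgebra k H] :
    Nontrivial (H 1) :=
  (counit k H).toRingHom.domain_nontrivial

/-- A right `π`-integral which is normalized somewhere is normalized everywhere. -/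
theorem IsRightIntegral.apply_one {lam : ∀ α : π, H α →ₗ[k] k}
    (hlam : IsRightIntegral k H lam) {α : π} (hα : lam α 1 = 1) (β : π) [Nontrivial (H β)] :
    lam β 1 = 1 := by
  have step {a b c : π} (h : a * b = c) [Nontrivial (H b)] (ha : lam a 1 = 1) :
      lam c 1 = 1 := by
    have e := hlam.sliceLeft_comulAt h 1
    rw [map_one, Algebra.TensorProduct.one_def, sliceLeft_tmul, ha] at e
    exact (smul_left_injective k (one_ne_zero (α := H b)) e).symm
  have : Nontrivial (H α) := by
    rw [← not_subsingleton_iff_nontrivial]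
    intro
    rw [Subsingleton.elim (1 : H α) 0, map_zero] at hα
    exact zero_ne_one hα
  have : Nontrivial (H α⁻¹) := nontrivial_of_mul_eq_one k H (inv_mul_cancel α)
  exact step (one_mul β) (step (mul_inv_cancel α) hα)

theorem exists_integral_of_complementedLattice (h : ComplementedLattice (subcoideals k H)) :
    ∃ lam : ∀ α : π, H α →ₗ[k] k, IsRightIntegral k H lam ∧
      ∀ α, Nontrivial (H α) → lam α 1 = 1 := by
  have hunit : (fun α => k ∙ (1 : H α)) ∈ subcoideals k H := by
    rw [mem_subcomodules, isGSubcomodule_iff]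
    intro α β f
    rw [Submodule.span_singleton_le_iff_mem, Submodule.mem_comap, LinearMap.comp_apply,
      AlgHom.toLinearMap_apply, map_one, Algebra.TensorProduct.one_def, sliceRight_tmul]
    exact Submodule.smul_mem _ _ (Submodule.mem_span_singleton_self _)
  obtain ⟨P, hP, hcompl⟩ := CompleteSublattice.isComplemented_iff.1 h _ hunit
  rw [Pi.isCompl_iff] at hcompl
  have hex (α : π) : ∃ l : H α →ₗ[k] k, P α ≤ LinearMap.ker l ∧ (Nontrivial (H α) → l 1 = 1) := by
    rcases subsingleton_or_nontrivial (H α) with _ | hα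
    · exact ⟨0, by simp, fun h => (not_subsingleton (H α) inferInstance).elim⟩
    have hnot : (1 : H α) ∉ P α := fun hmem =>
      one_ne_zero (Submodule.disjoint_def.1 (hcompl α).disjoint 1
        (Submodule.mem_span_singleton_self _) hmem)
    obtain ⟨f, hf, hPf⟩ := Submodule.exists_le_ker_of_notMem hnot
    refine ⟨(f 1)⁻¹ • f, fun x hx => ?_, fun _ => ?_⟩
    · simp [LinearMap.mem_ker.1 (hPf hx)]
    · simp [hf]
  choose lam hker hone using hex
  refine ⟨lam, fun α β x => ?_, hone⟩
  change sliceLeft (H β) (lam α) (Δ α β x) = _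
  rcases subsingleton_or_nontrivial (H (α * β)) with _ | hαβ
  · simp [Subsingleton.elim x 0]
  obtain ⟨y, hy, z, hz, rfl⟩ := Submodule.mem_sup.1
    (show x ∈ (k ∙ (1 : H (α * β))) ⊔ P (α * β) by
      rw [(hcompl (α * β)).sup_eq_top]; trivial)
  obtain ⟨c, rfl⟩ := Submodule.mem_span_singleton.1 hy
  have hone' : lam α 1 • (1 : H β) = lam (α * β) 1 • 1 := by
    rcases subsingleton_or_nontrivial (H β) with _ | hβ
    · exact Subsingleton.elim _ _
    have := nontrivial_of_mul_eq k H (rfl : α * β = α * β)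
    rw [hone α this, hone (α * β) hαβ]
  have hz0 : sliceLeft (H β) (lam α) (Δ α β z) = 0 := by
    obtain ⟨s, hs⟩ := hP α β z hz
    change sliceLeft (H β) (lam α) (comul k H α β z) = 0
    rw [← AlgHom.toLinearMap_apply, ← hs]
    clear hs
    induction s using TensorProduct.induction_on with
    | zero => simp
    | tmul u v => simp [LinearMap.mem_ker.1 (hker α u.2)]
    | add s t hs ht => simp only [map_add, hs, ht, add_zero]
  rw [map_add, map_add, hz0, map_add, LinearMap.mem_ker.1 (hker _ hz), map_smul, map_smul,
    map_one, Algebra.TensorProduct.one_def, sliceLeft_tmul, hone', map_smul]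
  simp [smul_smul]

end HopfGCoalgebra

theorem isGCosemisimple_iff_exists_integral (k : Type*) [Field k] {π : Type*} [Group π]
    (H : π → Type*) [∀ α, Ring (H α)] [∀ α, Algebra k (H α)] [HopfGCoalgebra k H] :
    IsGCosemisimple k H H (fun α β => (comul k H α β).toLinearMap) ↔
      ∃ lam : ∀ α : π, H α →ₗ[k] k, IsRightIntegral k H lam ∧
        ∀ α : π, Nontrivial (H α) → lam α (1 : H α) = 1 := by
  rw [isGCosemisimple_iff_complementedLattice]
  refine ⟨exists_integral_of_complementedLattice, fun ⟨lam, hlam, hone⟩ => ?_⟩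
  exact CompleteSublattice.isComplemented_iff.2 fun N hN =>
    exists_isCompl_of_integral hlam hone hN

/-- Theorem 5.2 (dual Maschke): `H` is cosemisimple iff there is a right `π`-integral
`λ` with `λ_α(1_α) = 1` for some `α`, iff there is one with `λ_α(1_α) = 1` for all `α`
with `H_α ≠ 0`. -/
theorem cosemisimple_iff_integral (k : Type*) [Field k] {π : Type*} [Group π]
    (H : π → Type*) [∀ α, Ring (H α)] [∀ α, Algebra k (H α)] [HopfGCoalgebra k H] :
    (IsGCosemisimple k H H (fun α β => (comul k H α β).toLinearMap)
      ↔ ∃ lam : ∀ α : π, H α →ₗ[k] k, IsRightIntegral k H lam ∧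
          ∃ α : π, lam α (1 : H α) = 1) ∧
    ((∃ lam : ∀ α : π, H α →ₗ[k] k, IsRightIntegral k H lam ∧
          ∃ α : π, lam α (1 : H α) = 1)
      ↔ ∃ lam : ∀ α : π, H α →ₗ[k] k, IsRightIntegral k H lam ∧
          ∀ α : π, Nontrivial (H α) → lam α (1 : H α) = 1) := by
  have normalized : (∃ lam : ∀ α : π, H α →ₗ[k] k, IsRightIntegral k H lam ∧
        ∃ α : π, lam α (1 : H α) = 1) ↔
      ∃ lam : ∀ α : π, H α →ₗ[k] k, IsRightIntegral k H lam ∧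
        ∀ α : π, Nontrivial (H α) → lam α (1 : H α) = 1 :=
    ⟨fun ⟨lam, hlam, _, hα⟩ => ⟨lam, hlam, fun β _ => hlam.apply_one hα β⟩,
      fun ⟨lam, hlam, h⟩ => ⟨lam, hlam, 1, h 1 (nontrivial_one k H)⟩⟩
  exact ⟨(isGCosemisimple_iff_exists_integral k H).trans normalized.symm, normalized⟩
end
end
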